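/- Let P, Q, η̂, t̄, α, K be natural numbers with 2 ≤ Q ≤ P, η̂ ≥ 1, and 1 ≤ t̄ ≤ Q−1, and set ν₂ = C(Q−1, Q−t̄−1). Then, as real numbers, K · C(P−1, Q−1) · (η̂·t̄ + α) · ν₂ / ( ∑_{r=1}^{P} ∑_{c=1}^{P−Q+1} ∑_{m=1}^{η̂} ∑_{s=1}^{ν₂} C(P−c−1, Q−2) ) = K·(η̂·t̄ + α) / (P·η̂). -/

import Mathlib

theorem hockey_aux (q d : ℕ) :
    ∑ c ∈ Finset.range (d + 1), Nat.choose (q + d - c) q = Nat.choose (q + d + 1) (q + 1) := by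
  induction d with
  | zero => simp
  | succ d ih =>
    rw [Finset.sum_range_succ', Nat.choose_succ_succ (q + (d + 1)) q, add_comm]
    congr 1
    rw [← add_assoc, ← ih]
    refine Finset.sum_congr rfl fun c _ => ?_
    congr 1
    omega

theorem hockey_Icc (P Q : ℕ) (hQ : 2 ≤ Q) (hQP : Q ≤ P) :
    ∑ c ∈ Finset.Icc 1 (P - Q + 1), Nat.choose (P - c - 1) (Q - 2)
      = Nat.choose (P - 1) (Q - 1) := by
  obtain ⟨q, rfl⟩ := Nat.exists_eq_add_of_le hQ
  obtain ⟨d, rfl⟩ := Nat.exists_eq_add_of_le hQP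
  have h := hockey_aux q d
  have e1 : 2 + q + d - 1 = q + d + 1 := by omega
  have e2 : 2 + q - 1 = q + 1 := by omega
  have e3 : 2 + q + d - (2 + q) + 1 = d + 1 := by omega
  have e4 : 2 + q - 2 = q := by omega
  rw [e1, e2, e3, e4, ← h, Finset.range_eq_Ico, Finset.sum_Ico_eq_sum_range,
    ← Finset.Ico_add_one_right_eq_Icc, Finset.sum_Ico_eq_sum_range]
  refine Finset.sum_congr (by simp) fun c _ => ?_
  congr 1
  omega

/-- Corollary 1, Strategy B part:
`K·C(P-1,Q-1)·(η̂t̄+α)·ν₂ / (∑_{r=1}^{P} ∑_{c=1}^{P-Q+1} ∑_{m=1}^{η̂} ∑_{s=1}^{ν₂}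
C(P-c-1,Q-2)) = K(η̂t̄+α)/(Pη̂)`. -/
theorem corollary1_strategyB (P Q etahat tbar α K ν₂ : ℕ)
    (hQ : 2 ≤ Q) (hQP : Q ≤ P) (heta : 1 ≤ etahat)
    (ht1 : 1 ≤ tbar) (ht2 : tbar ≤ Q - 1)
    (hν : ν₂ = Nat.choose (Q - 1) (Q - tbar - 1)) :
    ((K : ℝ) * ((P - 1).choose (Q - 1) : ℝ)
          * ((etahat : ℝ) * (tbar : ℝ) + (α : ℝ)) * (ν₂ : ℝ))
        / ((∑ r ∈ Finset.Icc 1 P, ∑ c ∈ Finset.Icc 1 (P - Q + 1),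
            ∑ m ∈ Finset.Icc 1 etahat, ∑ s ∈ Finset.Icc 1 ν₂,
              Nat.choose (P - c - 1) (Q - 2) : ℕ) : ℝ)
      = (K : ℝ) * ((etahat : ℝ) * (tbar : ℝ) + (α : ℝ)) / ((P : ℝ) * (etahat : ℝ)) := by
  have hsum : (∑ r ∈ Finset.Icc 1 P, ∑ c ∈ Finset.Icc 1 (P - Q + 1),
            ∑ m ∈ Finset.Icc 1 etahat, ∑ s ∈ Finset.Icc 1 ν₂,
              Nat.choose (P - c - 1) (Q - 2) : ℕ)
      = P * (etahat * (ν₂ * (P - 1).choose (Q - 1))) := by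
    simp only [Finset.sum_const, Nat.card_Icc, Nat.add_sub_cancel, smul_eq_mul,
      ← Finset.mul_sum, hockey_Icc P Q hQ hQP]
  rw [hsum]
  have h1 : (P : ℝ) ≠ 0 := by
    have : P ≠ 0 := by omega
    exact_mod_cast this
  have h2 : (etahat : ℝ) ≠ 0 := by
    have : etahat ≠ 0 := by omega
    exact_mod_cast this
  have h3 : (ν₂ : ℝ) ≠ 0 := by
    have : ν₂ ≠ 0 := by
      rw [hν]
      exact (Nat.choose_pos (by omega)).ne'
    exact_mod_cast this
  have h4 : ((P - 1).choose (Q - 1) : ℝ) ≠ 0 := by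
    have : (P - 1).choose (Q - 1) ≠ 0 := (Nat.choose_pos (by omega)).ne'
    exact_mod_cast this
  push_cast
  field_simp
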